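/- For each integer h ≥ 1 there exist rational functions Ã_h and B̃_h with rational coefficients such that for all complex q with 0 < |q| < 1: ã_h(q) = (−q;q)_∞ · Ã_h(q); if h is even then b̃_h(q) = (−q;q)_∞ · B̃_h(q); and if h is odd then b̃_h(q) = (−q;q)_∞ · ( B̃_h(q) + Σ_{k=1}^∞ q^k/(1+q^k) ). -/

import Mathlib

open Finset

/-- The number of parts of the partition `P` that are greater than `j`;
this is the length of column `j` (0-indexed) of the Ferrers diagram,
i.e. the conjugate part `λ'_{j+1}`. -/
def colLen {n : ℕ} (P : Nat.Partition n) (j : ℕ) : ℕ :=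
  (P.parts.filter (fun p => j < p)).card

/-- The length of row `i` (0-indexed) of the Ferrers diagram of `P`,
i.e. the `(i+1)`-st largest part `λ_{i+1}` (or `0` if there is none). -/
def rowLen {n : ℕ} (P : Nat.Partition n) (i : ℕ) : ℕ :=
  ((Finset.range (n + 1)).filter (fun j => i < colLen P j)).card

/-- The number of cells of the Ferrers diagram of `P` whose hook number
`(λ_i − j) + (λ'_j − i) + 1` (1-indexed) equals `h`. -/
def hookCount {n : ℕ} (P : Nat.Partition n) (h : ℕ) : ℕ :=
  (((Finset.range (n + 1)) ×ˢ (Finset.range (n + 1))).filter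
    (fun ij => ij.2 < rowLen P ij.1 ∧
      rowLen P ij.1 + colLen P ij.2 = h + ij.1 + ij.2 + 1)).card

/-- `a h n`: the total number of hooks of length `h` among partitions of `n` into odd parts. -/
def hookOdd (h n : ℕ) : ℕ := ∑ P ∈ Nat.Partition.odds n, hookCount P h

/-- `b h n`: the total number of hooks of length `h` among partitions of `n` into distinct parts. -/
def hookDistinct (h n : ℕ) : ℕ := ∑ P ∈ Nat.Partition.distincts n, hookCount P h

/-- The finite q-Pochhammer symbol `(x;q)_n = ∏_{i=0}^{n−1} (1 − x qⁱ)`. -/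
def qPoch (x q : ℂ) (n : ℕ) : ℂ := ∏ i ∈ Finset.range n, (1 - x * q ^ i)

/-- The infinite product `(−q;q)_∞ = ∏_{i=1}^∞ (1 + qⁱ)`. -/
noncomputable def negqInf (q : ℂ) : ℂ := ∏' i : ℕ, (1 + q ^ (i + 1))

/-- The Gaussian binomial coefficient `C(n,k)_q = (q;q)_n / ((q;q)_k (q;q)_{n−k})`. -/
noncomputable def qBinom (n k : ℕ) (q : ℂ) : ℂ := qPoch q q n / (qPoch q q k * qPoch q q (n - k))

/-- The generating function `ã_h(q) = Σ_{n≥0} a_h(n) qⁿ`. -/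
noncomputable def atilde (h : ℕ) (q : ℂ) : ℂ := ∑' n : ℕ, (hookOdd h n : ℂ) * q ^ n

/-- The generating function `b̃_h(q) = Σ_{n≥0} b_h(n) qⁿ`. -/
noncomputable def btilde (h : ℕ) (q : ℂ) : ℂ := ∑' n : ℕ, (hookDistinct h n : ℂ) * q ^ n
/-! ### Hooks counted by windows of parts -/

/-- The number of parts `p` in `s` with `j < p ≤ j + a`. -/
def windowCount (s : Multiset ℕ) (j a : ℕ) : ℕ := s.countP fun p => j < p ∧ p ≤ j + a

/-- Column `j` contains a cell with arm `a` and leg `l` in the diagram with parts `s`. -/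
def HasCell (a l : ℕ) (s : Multiset ℕ) (j : ℕ) : Prop :=
  windowCount s j a ≤ l ∧ l < windowCount s j (a + 1)

instance (a l : ℕ) (s : Multiset ℕ) : DecidablePred (HasCell a l s) :=
  fun _ => inferInstanceAs (Decidable (_ ∧ _))

@[simp]
lemma windowCount_zero_right (s : Multiset ℕ) (j : ℕ) : windowCount s j 0 = 0 := by
  rw [windowCount, Multiset.countP_eq_zero]
  intro p _
  omega

lemma windowCount_cons_of_mem {s : Multiset ℕ} {j a i : ℕ} (h : j < i ∧ i ≤ j + a) :
    windowCount (i ::ₘ s) j a = windowCount s j a + 1 :=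
  Multiset.countP_cons_of_pos _ h

lemma windowCount_cons_of_lt {s : Multiset ℕ} {j a i : ℕ} (h : j + a < i) :
    windowCount (i ::ₘ s) j a = windowCount s j a :=
  Multiset.countP_cons_of_neg _ (by omega)

lemma windowCount_succ (s : Multiset ℕ) (j a : ℕ) :
    windowCount s j (a + 1) = windowCount s j a + s.count (j + a + 1) := by
  induction s using Multiset.induction with
  | empty => simp [windowCount]
  | cons p s ih =>
    simp only [windowCount, Multiset.countP_cons, Multiset.count_cons] at ih ⊢
    rw [ih]
    split_ifs <;> omega

lemma countP_lt_eq_windowCount_add (s : Multiset ℕ) (j a : ℕ) :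
    s.countP (fun p => j < p) = windowCount s j a + s.countP (fun p => j + a < p) := by
  induction s using Multiset.induction with
  | empty => simp [windowCount]
  | cons p s ih =>
    simp only [windowCount, Multiset.countP_cons] at ih ⊢
    rw [ih]
    split_ifs <;> omega

lemma HasCell.lt_sum {a l : ℕ} {s : Multiset ℕ} {j : ℕ} (h : HasCell a l s j) : j < s.sum := by
  obtain ⟨p, hp, hjp⟩ := Multiset.countP_pos.1 (Nat.zero_lt_of_lt h.2)
  exact hjp.1.trans_le (Multiset.le_sum_of_mem hp)

lemma colLen_eq_windowCount_add {n : ℕ} (P : Nat.Partition n) (j a : ℕ) :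
    colLen P j = windowCount P.parts j a + colLen P (j + a) := by
  simp only [colLen, ← Multiset.countP_eq_card_filter]
  exact countP_lt_eq_windowCount_add _ _ _

lemma colLen_eq_zero {n : ℕ} (P : Nat.Partition n) {j : ℕ} (h : n ≤ j) : colLen P j = 0 := by
  rw [colLen, ← Multiset.countP_eq_card_filter, Multiset.countP_eq_zero]
  intro p hp
  have := P.le_of_mem_parts hp
  omega

lemma colLen_le {n : ℕ} (P : Nat.Partition n) (j : ℕ) : colLen P j ≤ n := by
  have h : P.parts.card • 1 ≤ P.parts.sum := Multiset.card_nsmul_le_sum fun p hp => P.parts_pos hp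
  rw [P.parts_sum, smul_eq_mul, mul_one] at h
  exact (Multiset.card_le_card (Multiset.filter_le _ _)).trans h

lemma lt_rowLen_iff {n : ℕ} (P : Nat.Partition n) (i j : ℕ) :
    j < rowLen P i ↔ i < colLen P j := by
  have anti : ∀ j k, j ≤ k → colLen P k ≤ colLen P j := fun j k hjk => by
    obtain ⟨a, rfl⟩ := Nat.exists_eq_add_of_le hjk
    have := colLen_eq_windowCount_add P j a
    omega
  constructor
  · intro h
    by_contra hc
    have hsub : (range (n + 1)).filter (fun j => i < colLen P j) ⊆ range j := by
      intro k hk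
      simp only [mem_filter, mem_range] at hk ⊢
      by_contra hkj
      have := anti j k (by omega)
      omega
    have := card_le_card hsub
    rw [card_range] at this
    exact absurd h (not_lt.2 this)
  · intro h
    have hj : j < n := by
      by_contra hj
      have := colLen_eq_zero P (not_lt.1 hj)
      omega
    have hsub : range (j + 1) ⊆ (range (n + 1)).filter (fun j => i < colLen P j) := by
      intro k hk
      simp only [mem_filter, mem_range] at hk ⊢
      have := anti k j (by omega)
      omega
    have := card_le_card hsub
    rw [card_range] at this
    exact this

/-- The number of cells with arm `a` and leg `l` in the diagram with parts `s`. -/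
def cellCount (a l : ℕ) (s : Multiset ℕ) : ℕ := #{j ∈ range (s.sum + 1) | HasCell a l s j}

lemma hookCount_eq_sum_cellCount {n : ℕ} (P : Nat.Partition n) (m : ℕ) :
    hookCount P (m + 1) = ∑ x ∈ antidiagonal m, cellCount x.1 x.2 P.parts := by
  simp only [cellCount, P.parts_sum]
  rw [← card_sigma]
  refine card_bij' (fun c _ => ⟨(rowLen P c.1 - c.2 - 1, colLen P c.2 - c.1 - 1), c.2⟩)
    (fun y _ => (colLen P y.2 - y.1.2 - 1, y.2)) ?_ ?_ ?_ ?_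
  · rintro ⟨i, j⟩ h
    simp only [mem_filter, mem_product, mem_range] at h
    obtain ⟨⟨hi, hj⟩, hlt, heq⟩ := h
    have h0 := (lt_rowLen_iff P i j).1 hlt
    simp only [mem_sigma, HasAntidiagonal.mem_antidiagonal, mem_filter, mem_range]
    refine ⟨by omega, hj, ?_⟩
    have h1 := colLen_eq_windowCount_add P j (rowLen P i - j - 1)
    have h2 := colLen_eq_windowCount_add P j (rowLen P i - j - 1 + 1)
    have h3 := lt_rowLen_iff P i (j + (rowLen P i - j - 1))
    have h4 := lt_rowLen_iff P i (j + (rowLen P i - j - 1 + 1))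
    constructor <;> omega
  · rintro ⟨⟨a, l⟩, j⟩ h
    simp only [mem_sigma, HasAntidiagonal.mem_antidiagonal, mem_filter, mem_range] at h
    obtain ⟨hal, hj, hc1, hc2⟩ := h
    have h1 := colLen_eq_windowCount_add P j a
    have h2 := colLen_eq_windowCount_add P j (a + 1)
    have h3 := lt_rowLen_iff P (colLen P j - l - 1) (j + a)
    have h4 := lt_rowLen_iff P (colLen P j - l - 1) (j + (a + 1))
    have h5 := colLen_le P j
    simp only [mem_filter, mem_product, mem_range]
    refine ⟨⟨by omega, hj⟩, by omega, by omega⟩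
  · rintro ⟨i, j⟩ h
    simp only [mem_filter, mem_product, mem_range] at h
    have := (lt_rowLen_iff P i j).1 h.2.1
    simp only [Prod.mk.injEq, and_true]
    omega
  · rintro ⟨⟨a, l⟩, j⟩ h
    simp only [mem_sigma, HasAntidiagonal.mem_antidiagonal, mem_filter, mem_range] at h
    obtain ⟨hal, hj, hc1, hc2⟩ := h
    have h1 := colLen_eq_windowCount_add P j a
    have h2 := colLen_eq_windowCount_add P j (a + 1)
    have h3 := lt_rowLen_iff P (colLen P j - l - 1) (j + a)
    have h4 := lt_rowLen_iff P (colLen P j - l - 1) (j + (a + 1))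
    have e1 : rowLen P (colLen P j - l - 1) - j - 1 = a := by omega
    have e2 : colLen P j - (colLen P j - l - 1) - 1 = l := by omega
    simp only [e1, e2]

/-! ### Weighted sums over multisets -/

/-- The weight `q ^ |s|` of a multiset of the class `C`, and `0` outside of `C`. -/
def weight (C : Multiset ℕ → Prop) [DecidablePred C] (q : ℂ) (s : Multiset ℕ) : ℂ :=
  if C s then q ^ s.sum else 0

/-- All elements are odd. -/
abbrev OddParts (s : Multiset ℕ) : Prop := ∀ p ∈ s, ¬ Even p

/-- The elements are distinct and positive. -/
abbrev DistinctParts (s : Multiset ℕ) : Prop := s.Nodup ∧ 0 ∉ s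

lemma norm_weight (C : Multiset ℕ → Prop) [DecidablePred C] (q : ℂ) (s : Multiset ℕ) :
    (‖weight C q s‖ : ℂ) = weight C (‖q‖ : ℂ) s := by
  unfold weight
  split_ifs <;> simp

lemma OddParts.zero_notMem {s : Multiset ℕ} (h : OddParts s) : 0 ∉ s := fun h0 => h 0 h0 (by simp)

lemma hasSum_sigma_partition_iff {E : Type*} [AddCommMonoid E] [TopologicalSpace E]
    {f : Multiset ℕ → E} (hf : ∀ s, 0 ∈ s → f s = 0) {A : E} :
    HasSum (fun x : Σ n, Nat.Partition n => f x.2.parts) A ↔ HasSum f A := by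
  have hinj : Function.Injective (fun x : Σ n, Nat.Partition n => x.2.parts) := by
    rintro ⟨n, P⟩ ⟨m, Q⟩ h
    simp only at h
    obtain rfl : n = m := by rw [← P.parts_sum, ← Q.parts_sum, h]
    rw [Nat.Partition.ext h]
  refine hinj.hasSum_iff (f := f) fun s hs => hf s ?_
  by_contra h0
  exact hs ⟨⟨s.sum, ⟨s, fun {i} hi => Nat.pos_of_ne_zero (fun h => h0 (h ▸ hi)), rfl⟩⟩, rfl⟩

lemma HasSum.sum_partition {f : Multiset ℕ → ℂ} (hf : ∀ s, 0 ∈ s → f s = 0) {A : ℂ}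
    (h : HasSum f A) : HasSum (fun n => ∑ P : Nat.Partition n, f P.parts) A :=
  ((hasSum_sigma_partition_iff hf).2 h).sigma fun _ => hasSum_fintype _

lemma hasSum_weight_distinct {q : ℂ} (hq : ‖q‖ < 1) :
    HasSum (weight DistinctParts q) (negqInf q) := by
  let e : Finset ℕ → Multiset ℕ := fun S => S.val.map (· + 1)
  have he : Function.Injective e := fun S T h =>
    Finset.val_injective (Multiset.map_injective (add_left_injective 1) h)
  have hsum : Summable fun n : ℕ => ‖q ^ (n + 1)‖ := by
    simp only [norm_pow]
    exact (summable_nat_add_iff 1).2 (summable_geometric_of_lt_one (norm_nonneg q) hq)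
  have hS := summable_finsetProd_of_summable_norm hsum
  have h2 : HasSum (fun S : Finset ℕ => ∏ i ∈ S, q ^ (i + 1)) (negqInf q) := by
    rw [negqInf, tprod_one_add hS]
    exact hS.hasSum
  rw [← he.hasSum_iff]
  · convert h2 using 2 with S
    have hC : DistinctParts (e S) :=
      ⟨S.nodup.map (add_left_injective 1), by simp [e]⟩
    simp only [Function.comp, weight, if_pos hC]
    rw [Finset.prod_pow_eq_pow_sum]
    rfl
  · intro s hs
    refine if_neg fun hC => hs ?_
    refine ⟨⟨s.map (· - 1), ?_⟩, ?_⟩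
    · refine Multiset.Nodup.map_on ?_ hC.1
      intro x hx y hy hxy
      have : x ≠ 0 := fun h => hC.2 (h ▸ hx)
      have : y ≠ 0 := fun h => hC.2 (h ▸ hy)
      omega
    · simp only [e, Multiset.map_map, Function.comp]
      conv_rhs => rw [← Multiset.map_id s]
      refine Multiset.map_congr rfl fun x hx => ?_
      have : x ≠ 0 := fun h => hC.2 (h ▸ hx)
      simp only [id]
      omega

lemma mem_distincts_iff {n : ℕ} (P : Nat.Partition n) :
    P ∈ Nat.Partition.distincts n ↔ DistinctParts P.parts := by
  have : 0 ∉ P.parts := fun h => (P.parts_pos h).ne rfl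
  simp [Nat.Partition.distincts, DistinctParts, this]

lemma mem_odds_iff {n : ℕ} (P : Nat.Partition n) :
    P ∈ Nat.Partition.odds n ↔ OddParts P.parts := by
  simp [Nat.Partition.odds, Nat.Partition.restricted, OddParts]

lemma sum_partition_mul_weight {C : Multiset ℕ → Prop} [DecidablePred C] {n : ℕ}
    {F : Finset (Nat.Partition n)} (hF : ∀ P, P ∈ F ↔ C P.parts) (c : Multiset ℕ → ℂ) (q : ℂ) :
    ∑ P : Nat.Partition n, c P.parts * weight C q P.parts = (∑ P ∈ F, c P.parts) * q ^ n := by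
  have hF' : F = univ.filter fun P => C P.parts := by ext P; simp [hF]
  rw [hF', sum_mul, sum_filter]
  refine sum_congr rfl fun P _ => ?_
  simp only [weight, P.parts_sum]
  split_ifs <;> simp

lemma hasSum_weight_odd {q : ℂ} (hq : ‖q‖ < 1) :
    HasSum (weight OddParts q) (negqInf q) := by
  have hD0 : ∀ (q : ℂ) (s : Multiset ℕ), 0 ∈ s → weight DistinctParts q s = 0 :=
    fun q s h => if_neg fun hC => hC.2 h
  have hO0 : ∀ (q : ℂ) (s : Multiset ℕ), 0 ∈ s → weight OddParts q s = 0 :=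
    fun q s h => if_neg fun hC => hC.zero_notMem h
  have hcard : ∀ (q : ℂ) (n : ℕ), ∑ P : Nat.Partition n, weight OddParts q P.parts =
      ∑ P : Nat.Partition n, weight DistinctParts q P.parts := by
    intro q n
    have h1 := sum_partition_mul_weight (mem_odds_iff (n := n)) (fun _ => 1) q
    have h2 := sum_partition_mul_weight (mem_distincts_iff (n := n)) (fun _ => 1) q
    simp only [one_mul, sum_const, nsmul_eq_mul, mul_one] at h1 h2
    rw [h1, h2, Nat.Partition.card_odds_eq_card_distincts]
  have hsum : Summable (weight OddParts q) := by
    have hr : ‖(‖q‖ : ℂ)‖ < 1 := by simpa using hq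
    have h1 := (hasSum_weight_distinct hr).sum_partition (hD0 _)
    simp only [← hcard] at h1
    simp only [← norm_weight] at h1
    have h2 : Summable fun x : Σ n, Nat.Partition n => ‖weight OddParts q x.2.parts‖ := by
      rw [summable_sigma_of_nonneg fun _ => norm_nonneg _]
      refine ⟨fun n => (hasSum_fintype _).summable, ?_⟩
      simp only [tsum_fintype]
      have := h1.summable
      norm_cast at this
    have h3 := h2.hasSum
    rw [hasSum_sigma_partition_iff (f := fun s => ‖weight OddParts q s‖)
      fun s h => by rw [hO0 q s h, norm_zero]] at h3
    exact h3.summable.of_norm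
  have h1 := hsum.hasSum.sum_partition (hO0 q)
  simp only [hcard] at h1
  have h2 := (hasSum_weight_distinct hq).sum_partition (hD0 q)
  rw [← h1.unique h2]
  exact hsum.hasSum

/-- If each column contributes `V q j` to a generating function, and these contributions sum
to `T q`, then the generating function counting cells equals `T q`. -/
lemma hasSum_cellCount_mul_weight {C : Multiset ℕ → Prop} [DecidablePred C] {a l : ℕ}
    {V : ℂ → ℕ → ℂ} {T : ℂ → ℂ}
    (hV : ∀ q : ℂ, 0 < ‖q‖ → ‖q‖ < 1 → ∀ j,
      HasSum (fun s => if HasCell a l s j then weight C q s else 0) (V q j))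
    (hT : ∀ q : ℂ, 0 < ‖q‖ → ‖q‖ < 1 → HasSum (V q) (T q))
    {q : ℂ} (h0 : 0 < ‖q‖) (h1 : ‖q‖ < 1) :
    HasSum (fun s => (cellCount a l s : ℂ) * weight C q s) (T q) := by
  let f : ℕ × Multiset ℕ → ℂ := fun x => if HasCell a l x.2 x.1 then weight C q x.2 else 0
  have hnorm : ∀ x, (‖f x‖ : ℂ) =
      if HasCell a l x.2 x.1 then weight C (‖q‖ : ℂ) x.2 else 0 := by
    intro x
    simp only [f, ← norm_weight]
    split_ifs <;> simp
  have hr0 : 0 < ‖(‖q‖ : ℂ)‖ := by simpa using h0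
  have hr1 : ‖(‖q‖ : ℂ)‖ < 1 := by simpa using h1
  have hV' : ∀ j, HasSum (fun s => (‖f (j, s)‖ : ℂ)) (V (‖q‖ : ℂ) j) := by
    intro j
    simp only [hnorm]
    exact hV _ hr0 hr1 j
  have hf : Summable f := by
    refine Summable.of_norm ?_
    rw [summable_prod_of_nonneg fun _ => norm_nonneg _]
    refine ⟨fun j => by have := (hV' j).summable; norm_cast at this, ?_⟩
    have := (hT _ hr0 hr1).summable
    rw [← funext fun j => (hV' j).tsum_eq] at this
    simp only [← Complex.ofReal_tsum] at this
    norm_cast at this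
  have htot : HasSum f (T q) := by
    have := hf.hasSum.prod_fiberwise (hV q h0 h1)
    rw [(hT q h0 h1).unique this]
    exact hf.hasSum
  have hswap : HasSum (f ∘ Equiv.prodComm (Multiset ℕ) ℕ) (T q) :=
    (Equiv.hasSum_iff _).2 htot
  refine hswap.prod_fiberwise fun s => ?_
  have hfin : ∀ j ∉ range (s.sum + 1), f (j, s) = 0 := by
    intro j hj
    refine if_neg fun hc => hj ?_
    have := hc.lt_sum
    simp only at this
    rw [mem_range]
    omega
  have hsum : HasSum (fun j => f (j, s)) (∑ j ∈ range (s.sum + 1), f (j, s)) :=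
    hasSum_sum_of_ne_finset_zero hfin
  simp only [f, ← sum_filter, sum_const, nsmul_eq_mul] at hsum
  exact hsum

lemma HasSum.ite_mem_of_cons {i : ℕ} {f : Multiset ℕ → ℂ} {A : ℂ}
    (h : HasSum (fun s => f (i ::ₘ s)) A) : HasSum (fun s => if i ∈ s then f s else 0) A := by
  have hinj : Function.Injective (Multiset.cons i) := fun s t h => (Multiset.cons_inj_right i).1 h
  rw [← hinj.hasSum_iff]
  · simpa [Function.comp_def] using h
  · intro s hs
    refine if_neg fun hi => hs ⟨s.erase i, Multiset.cons_erase hi⟩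

lemma HasSum.of_eq {ι : Type*} {f g : ι → ℂ} {A B : ℂ} (h : HasSum f A) (hgf : ∀ x, g x = f x)
    (hBA : B = A) : HasSum g B :=
  hBA ▸ h.congr_fun hgf

/-! ### Rational functions on the punctured unit disc -/

/-- On the punctured unit disc, `f` is given by a rational function over `ℚ` without poles there. -/
def IsRationalOnDisc (f : ℂ → ℂ) : Prop :=
  ∃ P Q : Polynomial ℚ, (∀ q : ℂ, 0 < ‖q‖ → ‖q‖ < 1 → Polynomial.aeval q Q ≠ 0) ∧
    ∀ q : ℂ, 0 < ‖q‖ → ‖q‖ < 1 → f q = Polynomial.aeval q P / Polynomial.aeval q Q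

namespace IsRationalOnDisc

lemma aeval (P : Polynomial ℚ) : IsRationalOnDisc fun q => Polynomial.aeval q P :=
  ⟨P, 1, by simp, by simp⟩

lemma pow (n : ℕ) : IsRationalOnDisc fun q => q ^ n := by
  simpa using aeval (Polynomial.X ^ n)

lemma congr {f g : ℂ → ℂ} (hf : IsRationalOnDisc f)
    (h : ∀ q : ℂ, 0 < ‖q‖ → ‖q‖ < 1 → g q = f q) : IsRationalOnDisc g := by
  obtain ⟨P, Q, hQ, hPQ⟩ := hf
  exact ⟨P, Q, hQ, fun q h0 h1 => (h q h0 h1).trans (hPQ q h0 h1)⟩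

lemma add {f g : ℂ → ℂ} (hf : IsRationalOnDisc f) (hg : IsRationalOnDisc g) :
    IsRationalOnDisc fun q => f q + g q := by
  obtain ⟨P, Q, hQ, hf⟩ := hf
  obtain ⟨R, S, hS, hg⟩ := hg
  refine ⟨P * S + Q * R, Q * S, fun q h0 h1 => ?_, fun q h0 h1 => ?_⟩
  · simpa using ⟨hQ q h0 h1, hS q h0 h1⟩
  · simp only [hf q h0 h1, hg q h0 h1, div_add_div _ _ (hQ q h0 h1) (hS q h0 h1), map_add, map_mul]

lemma mul {f g : ℂ → ℂ} (hf : IsRationalOnDisc f) (hg : IsRationalOnDisc g) :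
    IsRationalOnDisc fun q => f q * g q := by
  obtain ⟨P, Q, hQ, hf⟩ := hf
  obtain ⟨R, S, hS, hg⟩ := hg
  refine ⟨P * R, Q * S, fun q h0 h1 => ?_, fun q h0 h1 => ?_⟩
  · simpa using ⟨hQ q h0 h1, hS q h0 h1⟩
  · simp only [hf q h0 h1, hg q h0 h1, div_mul_div_comm, map_mul]

lemma sub {f g : ℂ → ℂ} (hf : IsRationalOnDisc f) (hg : IsRationalOnDisc g) :
    IsRationalOnDisc fun q => f q - g q :=
  (hf.add ((aeval (-1)).mul hg)).congr fun q _ _ => by simp [sub_eq_add_neg]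

lemma div_aeval {f : ℂ → ℂ} (hf : IsRationalOnDisc f) {R : Polynomial ℚ}
    (hR : ∀ q : ℂ, 0 < ‖q‖ → ‖q‖ < 1 → Polynomial.aeval q R ≠ 0) :
    IsRationalOnDisc fun q => f q / Polynomial.aeval q R :=
  (hf.mul (g := fun q => 1 / Polynomial.aeval q R) ⟨1, R, hR, by simp⟩).congr fun q _ _ => by
    rw [mul_one_div]

lemma sum {ι : Type*} (s : Finset ι) {f : ι → ℂ → ℂ} (hf : ∀ i, IsRationalOnDisc (f i)) :
    IsRationalOnDisc fun q => ∑ i ∈ s, f i q := by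
  classical
  induction s using Finset.induction with
  | empty => simpa using aeval 0
  | insert i s hi ih => simpa only [sum_insert hi] using (hf i).add ih

lemma exists_ne_zero {f : ℂ → ℂ} (hf : IsRationalOnDisc f) :
    ∃ P Q : Polynomial ℚ, Q ≠ 0 ∧
      ∀ q : ℂ, 0 < ‖q‖ → ‖q‖ < 1 → f q = Polynomial.aeval q P / Polynomial.aeval q Q := by
  obtain ⟨P, Q, hQ, hf⟩ := hf
  refine ⟨P, Q, ?_, hf⟩
  rintro rfl
  exact hQ (1 / 2) (by norm_num) (by norm_num) (map_zero _)

end IsRationalOnDisc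

lemma one_sub_pow_ne_zero {q : ℂ} (h1 : ‖q‖ < 1) {n : ℕ} (hn : n ≠ 0) : 1 - q ^ n ≠ 0 := by
  intro h
  have h2 : ‖q ^ n‖ = 1 := by rw [← sub_eq_zero.1 h, norm_one]
  rw [norm_pow] at h2
  exact (pow_lt_one₀ (norm_nonneg q) h1 hn).ne h2

lemma one_sub_norm_le {q : ℂ} (h1 : ‖q‖ < 1) {n : ℕ} (hn : n ≠ 0) :
    1 - ‖q‖ ≤ ‖1 + q ^ n‖ := by
  have h2 : ‖q‖ ^ n ≤ ‖q‖ := pow_le_of_le_one (norm_nonneg q) h1.le hn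
  have h3 := norm_sub_le (1 + q ^ n) (q ^ n)
  rw [add_sub_cancel_right, norm_one, norm_pow] at h3
  linarith

lemma one_add_pow_ne_zero {q : ℂ} (h1 : ‖q‖ < 1) {n : ℕ} (hn : n ≠ 0) : 1 + q ^ n ≠ 0 :=
  norm_pos_iff.1 ((sub_pos.2 h1).trans_le (one_sub_norm_le h1 hn))

/-! ### Partitions into odd parts -/

/-- Evaluation of a polynomial in `x` with coefficients in `ℚ[q]`. -/
noncomputable def bieval (q x : ℂ) : Polynomial (Polynomial ℚ) →+* ℂ :=
  Polynomial.eval₂RingHom (Polynomial.aeval q).toRingHom x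

@[simp]
lemma bieval_X (q x : ℂ) : bieval q x Polynomial.X = x := by simp [bieval]

@[simp]
lemma bieval_C (q x : ℂ) (c : Polynomial ℚ) :
    bieval q x (Polynomial.C c) = Polynomial.aeval q c := by
  simp [bieval]

/-- For `j ≡ ε` modulo `2`, evaluating at `x = q ^ j` gives the proportion of partitions into odd
parts that have less than `l` parts in the window `(j, j + a]`. -/
noncomputable def oddPoly (ε : ℕ) : ℕ → ℕ → Polynomial (Polynomial ℚ)
  | _, 0 => 0
  | 0, _ + 1 => 1
  | a + 1, l + 1 =>
    if Even (ε + a) then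
      (1 - Polynomial.X * Polynomial.C (Polynomial.X ^ (a + 1))) * oddPoly ε a (l + 1) +
        Polynomial.X * Polynomial.C (Polynomial.X ^ (a + 1)) * oddPoly ε (a + 1) l
    else oddPoly ε a (l + 1)
termination_by a l => (a, l)

lemma coeff_zero_oddPoly (ε a l : ℕ) : (oddPoly ε a (l + 1)).coeff 0 = 1 := by
  induction a with
  | zero => simp [oddPoly]
  | succ a ih =>
    rw [oddPoly]
    split_ifs
    · simp [Polynomial.mul_coeff_zero, ih]
    · exact ih

lemma weight_odd_cons {q : ℂ} {i : ℕ} (hi : ¬ Even i) (s : Multiset ℕ) :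
    weight OddParts q (i ::ₘ s) = q ^ i * weight OddParts q s := by
  simp only [weight, OddParts, Multiset.forall_mem_cons, hi, not_false_eq_true, true_and,
    Multiset.sum_cons, pow_add, mul_ite, mul_zero]

lemma hasSum_windowCount_lt_odd {q : ℂ} (hq : ‖q‖ < 1) (j ε a l : ℕ) (hj : j % 2 = ε % 2) :
    HasSum (fun s => if windowCount s j a < l then weight OddParts q s else 0)
      (negqInf q * bieval q (q ^ j) (oddPoly ε a l)) := by
  induction a generalizing l with
  | zero =>
    cases l with
    | zero => simp [oddPoly, hasSum_zero]
    | succ l => simpa [oddPoly] using hasSum_weight_odd hq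
  | succ a iha =>
    induction l with
    | zero => simp [oddPoly, hasSum_zero]
    | succ l ihl =>
      have U := iha (l + 1)
      rw [oddPoly]
      split_ifs with hε
      · have hi : ¬ Even (j + a + 1) := by
          rw [Nat.even_iff] at hε ⊢
          omega
        have S1 : HasSum (fun s => if j + a + 1 ∈ s then
            (if windowCount s j a < l + 1 then weight OddParts q s else 0) else 0)
            (q ^ (j + a + 1) * (negqInf q * bieval q (q ^ j) (oddPoly ε a (l + 1)))) := by
          refine HasSum.ite_mem_of_cons ((U.mul_left (q ^ (j + a + 1))).congr_fun ?_)
          intro s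
          rw [windowCount_cons_of_lt (by omega), weight_odd_cons hi, mul_ite, mul_zero]
        have S2 : HasSum (fun s => if j + a + 1 ∈ s then
            (if windowCount s j (a + 1) < l + 1 then weight OddParts q s else 0) else 0)
            (q ^ (j + a + 1) * (negqInf q * bieval q (q ^ j) (oddPoly ε (a + 1) l))) := by
          refine HasSum.ite_mem_of_cons ((ihl.mul_left (q ^ (j + a + 1))).congr_fun ?_)
          intro s
          rw [windowCount_cons_of_mem (by omega), weight_odd_cons hi, mul_ite, mul_zero]
          simp only [Nat.add_lt_add_iff_right]
        refine HasSum.of_eq ((U.sub S1).add S2) (fun s => ?_) ?_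
        · by_cases hs : j + a + 1 ∈ s
          · simp [hs]
          · simp [hs, windowCount_succ]
        · simp only [map_add, map_mul, map_sub, map_one, bieval_X, bieval_C, map_pow,
            Polynomial.aeval_X]
          ring
      · refine U.congr_fun fun s => ?_
        by_cases hC : OddParts s
        · have : j + a + 1 ∉ s := fun h => hC _ h (by
            rw [Nat.even_iff] at hε ⊢
            omega)
          simp [windowCount_succ, this]
        · simp [weight, hC]

lemma hasSum_hasCell_odd {q : ℂ} (hq : ‖q‖ < 1) (a l j ε : ℕ) (hj : j % 2 = ε % 2) :
    HasSum (fun s => if HasCell a l s j then weight OddParts q s else 0)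
      (negqInf q * bieval q (q ^ j) (oddPoly ε a (l + 1) - oddPoly ε (a + 1) (l + 1))) := by
  rw [map_sub, mul_sub]
  refine ((hasSum_windowCount_lt_odd hq j ε a (l + 1) hj).sub
    (hasSum_windowCount_lt_odd hq j ε (a + 1) (l + 1) hj)).congr_fun fun s => ?_
  have := windowCount_succ s j a
  have hcell : HasCell a l s j ↔ windowCount s j a < l + 1 ∧ ¬ windowCount s j (a + 1) < l + 1 := by
    unfold HasCell
    omega
  rw [if_congr hcell rfl rfl]
  by_cases h1 : windowCount s j a < l + 1
  · by_cases h2 : windowCount s j (a + 1) < l + 1 <;> simp only [h1, h2] <;> simp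
  · have h2 : ¬ windowCount s j (a + 1) < l + 1 := by omega
    simp only [h1, h2]
    simp

lemma exists_hasSum_bieval (ε : ℕ) (R : Polynomial (Polynomial ℚ)) :
    ∃ f, IsRationalOnDisc f ∧ ∀ q : ℂ, 0 < ‖q‖ → ‖q‖ < 1 →
      HasSum (fun k => bieval q (q ^ (2 * k + ε)) (Polynomial.X * R)) (f q) := by
  induction R using Polynomial.induction_on' with
  | add R S hR hS =>
    obtain ⟨f, hf, hfs⟩ := hR
    obtain ⟨g, hg, hgs⟩ := hS
    refine ⟨_, hf.add hg, fun q h0 h1 => ?_⟩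
    simp only [mul_add, map_add]
    exact (hfs q h0 h1).add (hgs q h0 h1)
  | monomial m c =>
    refine ⟨_, ((IsRationalOnDisc.aeval c).mul (.pow (ε * (m + 1)))).div_aeval
      (R := 1 - Polynomial.X ^ (2 * (m + 1))) fun q h0 h1 => ?_, fun q h0 h1 => ?_⟩
    · simpa using one_sub_pow_ne_zero h1 (n := 2 * (m + 1)) (by omega)
    · have hgeom : HasSum (fun k => (q ^ (2 * (m + 1))) ^ k) (1 - q ^ (2 * (m + 1)))⁻¹ := by
        refine hasSum_geometric_of_norm_lt_one ?_
        rw [norm_pow]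
        exact pow_lt_one₀ (norm_nonneg q) h1 (by omega)
      refine HasSum.of_eq (hgeom.mul_left (Polynomial.aeval q c * q ^ (ε * (m + 1))))
        (fun k => ?_) ?_
      · rw [← Polynomial.C_mul_X_pow_eq_monomial]
        simp only [map_mul, map_pow, bieval_X, bieval_C]
        ring
      · simp [div_eq_mul_inv]

lemma exists_hasSum_cellCount_odd (a l : ℕ) :
    ∃ f, IsRationalOnDisc f ∧ ∀ q : ℂ, 0 < ‖q‖ → ‖q‖ < 1 →
      HasSum (fun s => (cellCount a l s : ℂ) * weight OddParts q s) (negqInf q * f q) := by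
  have hX : ∀ ε, ∃ R, oddPoly ε a (l + 1) - oddPoly ε (a + 1) (l + 1) = Polynomial.X * R :=
    fun ε => Polynomial.X_dvd_iff.2 (by simp [coeff_zero_oddPoly])
  obtain ⟨R₀, hR₀⟩ := hX 0
  obtain ⟨R₁, hR₁⟩ := hX 1
  obtain ⟨f, hf, hfs⟩ := exists_hasSum_bieval 0 R₀
  obtain ⟨g, hg, hgs⟩ := exists_hasSum_bieval 1 R₁
  refine ⟨_, hf.add hg, fun q h0 h1 => ?_⟩
  refine hasSum_cellCount_mul_weight (T := fun q => negqInf q * (f q + g q))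
    (fun q _ h1 j => hasSum_hasCell_odd h1 a l j (j % 2) (by simp)) (fun q h0 h1 => ?_) h0 h1
  refine HasSum.mul_left _ (HasSum.even_add_odd ?_ ?_)
  · refine (hfs q h0 h1).congr_fun fun k => ?_
    rw [← hR₀, Nat.mul_mod_right, add_zero]
  · refine (hgs q h0 h1).congr_fun fun k => ?_
    rw [← hR₁, Nat.mul_add_mod]

/-! ### Partitions into distinct parts -/

/-- The elementary symmetric polynomial of degree `t` in `q, q², …, qᵃ`. -/
noncomputable def distinctPoly : ℕ → ℕ → Polynomial ℚ
  | _, 0 => 1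
  | 0, _ + 1 => 0
  | a + 1, t + 1 => distinctPoly a (t + 1) + Polynomial.X ^ (a + 1) * distinctPoly a t

lemma distinctPoly_eq_zero {a t : ℕ} (h : a < t) : distinctPoly a t = 0 := by
  induction a generalizing t with
  | zero =>
    obtain ⟨t, rfl⟩ := Nat.exists_eq_succ_of_ne_zero h.ne'
    rw [distinctPoly]
  | succ a ih =>
    obtain ⟨t, rfl⟩ := Nat.exists_eq_succ_of_ne_zero (Nat.ne_zero_of_lt h)
    rw [distinctPoly, ih (by omega), ih (by omega), mul_zero, add_zero]

lemma distinctPoly_succ_self (a : ℕ) :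
    distinctPoly (a + 1) (a + 1) = Polynomial.X ^ (a + 1) * distinctPoly a a := by
  rw [distinctPoly, distinctPoly_eq_zero (by omega), zero_add]

/-- The product `(1 + q ^ (j + 1)) ⋯ (1 + q ^ (j + a))`. -/
def windowProd (q : ℂ) (j a : ℕ) : ℂ := ∏ k ∈ range a, (1 + q ^ (j + k + 1))

lemma windowProd_succ (q : ℂ) (j a : ℕ) :
    windowProd q j (a + 1) = windowProd q j a * (1 + q ^ (j + a + 1)) :=
  prod_range_succ _ _

lemma windowProd_succ' (q : ℂ) (j a : ℕ) :
    windowProd q j (a + 1) = windowProd q (j + 1) a * (1 + q ^ (j + 1)) := by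
  rw [windowProd, prod_range_succ']
  simp only [windowProd, add_zero, add_assoc, add_comm 1]

lemma windowProd_ne_zero {q : ℂ} (h1 : ‖q‖ < 1) (j a : ℕ) : windowProd q j a ≠ 0 :=
  prod_ne_zero_iff.2 fun _ _ => one_add_pow_ne_zero h1 (Nat.succ_ne_zero _)

lemma hasSum_windowCount_eq_notMem_distinct {q : ℂ} (hq : ‖q‖ < 1) {j a t : ℕ} {U : ℂ}
    (hU : HasSum (fun s => if windowCount s j a = t then weight DistinctParts q s else 0) U) :
    HasSum (fun s => if j + a + 1 ∉ s then
        (if windowCount s j a = t then weight DistinctParts q s else 0) else 0)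
        (U / (1 + q ^ (j + a + 1))) ∧
      HasSum (fun s => if j + a + 1 ∈ s then
        (if windowCount s j a = t then weight DistinctParts q s else 0) else 0)
        (q ^ (j + a + 1) * (U / (1 + q ^ (j + a + 1)))) := by
  have hsum : Summable (fun s => if j + a + 1 ∉ s then
      (if windowCount s j a = t then weight DistinctParts q s else 0) else 0) := by
    refine hU.summable.norm.of_norm_bounded fun s => ?_
    split_ifs <;> simp
  obtain ⟨A, hA⟩ := hsum
  have hB : HasSum (fun s => if j + a + 1 ∈ s then
      (if windowCount s j a = t then weight DistinctParts q s else 0) else 0)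
      (q ^ (j + a + 1) * A) := by
    refine HasSum.ite_mem_of_cons ((hA.mul_left (q ^ (j + a + 1))).congr_fun fun s => ?_)
    rw [windowCount_cons_of_lt (by omega)]
    by_cases hs : j + a + 1 ∈ s
    · simp [hs, weight]
    · simp only [hs, weight, DistinctParts, Multiset.nodup_cons, Multiset.mem_cons, not_false_eq_true,
        true_and, if_true, Multiset.sum_cons, pow_add, mul_ite, mul_zero]
      simp
  have hAU : A * (1 + q ^ (j + a + 1)) = U := by
    refine HasSum.unique ?_ hU
    convert hA.add hB using 1
    · funext s
      by_cases hs : j + a + 1 ∈ s <;> simp [hs]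
    · ring
  rw [← hAU, mul_div_cancel_right₀ _ (one_add_pow_ne_zero hq (by omega))]
  exact ⟨hA, hB⟩

lemma hasSum_windowCount_eq_distinct {q : ℂ} (hq : ‖q‖ < 1) (j a t : ℕ) :
    HasSum (fun s => if windowCount s j a = t then weight DistinctParts q s else 0)
      (negqInf q * (Polynomial.aeval q (distinctPoly a t) * q ^ (j * t) / windowProd q j a)) := by
  induction a generalizing t with
  | zero =>
    cases t with
    | zero => simpa [distinctPoly, windowProd] using hasSum_weight_distinct hq
    | succ t => simp [distinctPoly, hasSum_zero]
  | succ a ih =>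
    have hW := windowProd_ne_zero hq j a
    have hi := one_add_pow_ne_zero hq (Nat.succ_ne_zero (j + a))
    cases t with
    | zero =>
      refine HasSum.congr_fun ?_ ?_ (f := fun s => if j + a + 1 ∉ s then
        (if windowCount s j a = 0 then weight DistinctParts q s else 0) else 0)
      · convert (hasSum_windowCount_eq_notMem_distinct hq (ih 0)).1 using 1
        rw [windowProd_succ]
        simp only [distinctPoly]
        field_simp
      · intro s
        by_cases hs : j + a + 1 ∈ s
        · simp [hs, windowCount_succ]
        · simp [hs, windowCount_succ]
    | succ t =>
      refine HasSum.congr_fun ?_ ?_ (f := fun s => (if j + a + 1 ∉ s then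
        (if windowCount s j a = t + 1 then weight DistinctParts q s else 0) else 0) +
        (if j + a + 1 ∈ s then
        (if windowCount s j a = t then weight DistinctParts q s else 0) else 0))
      · convert (hasSum_windowCount_eq_notMem_distinct hq (ih (t + 1))).1.add
          (hasSum_windowCount_eq_notMem_distinct hq (ih t)).2 using 1
        rw [windowProd_succ]
        simp only [distinctPoly, map_add, map_mul, map_pow, Polynomial.aeval_X]
        field_simp
        ring
      · intro s
        by_cases hC : DistinctParts s
        · by_cases hs : j + a + 1 ∈ s
          · simp [hs, windowCount_succ, Multiset.count_eq_one_of_mem hC.1 hs]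
          · simp [hs, windowCount_succ]
        · simp [weight, hC]

lemma hasSum_hasCell_distinct {q : ℂ} (hq : ‖q‖ < 1) (a l j : ℕ) :
    HasSum (fun s => if HasCell a l s j then weight DistinctParts q s else 0)
      (negqInf q * (Polynomial.aeval q (distinctPoly a l) * q ^ (a + 1) *
        (q ^ (j * (l + 1)) / windowProd q j (a + 1)))) := by
  refine HasSum.congr_fun ?_ ?_ (f := fun s => if j + a + 1 ∈ s then
    (if windowCount s j a = l then weight DistinctParts q s else 0) else 0)
  · convert (hasSum_windowCount_eq_notMem_distinct hq
      (hasSum_windowCount_eq_distinct hq j a l)).2 using 1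
    have hW := windowProd_ne_zero hq j a
    have hi := one_add_pow_ne_zero hq (Nat.succ_ne_zero (j + a))
    rw [windowProd_succ]
    field_simp
    ring
  · intro s
    by_cases hC : DistinctParts s
    · by_cases hs : j + a + 1 ∈ s
      · simp only [HasCell, windowCount_succ, Multiset.count_eq_one_of_mem hC.1 hs, hs, if_true]
        congr 1
        simp only [eq_iff_iff]
        omega
      · simp only [HasCell, windowCount_succ, Multiset.count_eq_zero_of_notMem hs, hs, if_false]
        rw [if_neg (by omega)]
    · simp [weight, hC]

lemma summable_pow_div_windowProd {q : ℂ} (h1 : ‖q‖ < 1) (a l : ℕ) :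
    Summable fun j => q ^ (j * (l + 1)) / windowProd q j a := by
  have hpos : 0 < 1 - ‖q‖ := sub_pos.2 h1
  have hgeom : Summable fun j : ℕ => (‖q‖ ^ (l + 1)) ^ j * ((1 - ‖q‖) ^ a)⁻¹ :=
    (summable_geometric_of_lt_one (by positivity)
      (pow_lt_one₀ (norm_nonneg q) h1 (by omega))).mul_right _
  refine hgeom.of_norm_bounded fun j => ?_
  rw [norm_div, div_eq_mul_inv, norm_pow, mul_comm j, pow_mul]
  have hW : (1 - ‖q‖) ^ a ≤ ‖windowProd q j a‖ := by
    rw [windowProd, norm_prod]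
    calc (1 - ‖q‖) ^ a = ∏ _k ∈ range a, (1 - ‖q‖) := by simp
      _ ≤ _ := prod_le_prod (fun _ _ => hpos.le) fun k _ => one_sub_norm_le h1 (by omega)
  gcongr

/-- The sum over all `j` of `q ^ (j * (l + 1)) / windowProd q j (a + 1)`. -/
noncomputable def columnSum (a l : ℕ) (q : ℂ) : ℂ :=
  ∑' j, q ^ (j * (l + 1)) / windowProd q j (a + 1)

lemma hasSum_columnSum {q : ℂ} (h1 : ‖q‖ < 1) (a l : ℕ) :
    HasSum (fun j => q ^ (j * (l + 1)) / windowProd q j (a + 1)) (columnSum a l q) :=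
  (summable_pow_div_windowProd h1 (a + 1) l).hasSum

lemma columnSum_telescope {q : ℂ} (h1 : ‖q‖ < 1) (a l : ℕ) :
    (1 - q ^ (l + 1)) * columnSum a l q + (q ^ (a + 1) - q ^ (l + 2)) * columnSum a (l + 1) q =
      1 / windowProd q 0 a := by
  have hG := summable_pow_div_windowProd h1 a l
  have hshift := (hasSum_nat_add_iff' 1).2 hG.hasSum
  have hdiff := hG.hasSum.sub hshift
  simp only [range_one, sum_singleton, sub_sub_cancel, zero_mul, pow_zero] at hdiff
  refine HasSum.unique ?_ hdiff
  refine HasSum.congr_fun (((hasSum_columnSum h1 a l).mul_left (1 - q ^ (l + 1))).add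
    ((hasSum_columnSum h1 a (l + 1)).mul_left (q ^ (a + 1) - q ^ (l + 2)))) fun j => ?_
  have hj := one_add_pow_ne_zero h1 (Nat.succ_ne_zero j)
  have hi := one_add_pow_ne_zero h1 (Nat.succ_ne_zero (j + a))
  have e1 : q ^ (j * (l + 1)) / windowProd q j a =
      q ^ (j * (l + 1)) * (1 + q ^ (j + a + 1)) / windowProd q j (a + 1) := by
    rw [windowProd_succ, mul_div_mul_right _ _ hi]
  have e2 : q ^ ((j + 1) * (l + 1)) / windowProd q (j + 1) a =
      q ^ ((j + 1) * (l + 1)) * (1 + q ^ (j + 1)) / windowProd q j (a + 1) := by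
    rw [windowProd_succ', mul_div_mul_right _ _ hj]
  rw [e1, e2, ← sub_div, mul_div_assoc', mul_div_assoc', ← add_div]
  congr 1
  ring

lemma isRationalOnDisc_one_div_windowProd (a : ℕ) :
    IsRationalOnDisc fun q => 1 / windowProd q 0 a := by
  have haeval : ∀ q : ℂ, Polynomial.aeval q
      (∏ k ∈ range a, (1 + Polynomial.X ^ (0 + k + 1) : Polynomial ℚ)) = windowProd q 0 a := by
    simp [windowProd, map_prod]
  refine ⟨1, ∏ k ∈ range a, (1 + Polynomial.X ^ (0 + k + 1)), fun q _ h1 => ?_, fun q _ _ => ?_⟩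
  · rw [haeval]
    exact windowProd_ne_zero h1 0 a
  · rw [haeval, map_one]

lemma isRationalOnDisc_columnSum (d l : ℕ) : IsRationalOnDisc (columnSum (l + 1 + d) l) := by
  have key : ∀ a l : ℕ,
      IsRationalOnDisc (fun q => (q ^ (a + 1) - q ^ (l + 2)) * columnSum a (l + 1) q) →
      IsRationalOnDisc (columnSum a l) := by
    intro a l h
    refine (((isRationalOnDisc_one_div_windowProd a).sub h).div_aeval
      (R := 1 - Polynomial.X ^ (l + 1)) fun q _ h1 => ?_).congr fun q _ h1 => ?_
    · simpa using one_sub_pow_ne_zero h1 (Nat.succ_ne_zero l)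
    · have hne := one_sub_pow_ne_zero h1 (Nat.succ_ne_zero l)
      simp only [map_sub, map_one, map_pow, Polynomial.aeval_X]
      rw [← columnSum_telescope h1 a l, add_sub_cancel_right, mul_div_cancel_left₀ _ hne]
  induction d generalizing l with
  | zero =>
    refine key _ _ ((IsRationalOnDisc.aeval 0).congr fun q _ _ => ?_)
    simp
  | succ d ih =>
    refine key _ _ (((IsRationalOnDisc.pow _).sub (.pow _)).mul ?_)
    convert ih (l + 1) using 2
    omega

lemma columnSum_succ_succ {q : ℂ} (h1 : ‖q‖ < 1) (a : ℕ) :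
    q ^ (a + 2) * columnSum (a + 1) (a + 1) q = columnSum a a q - columnSum (a + 1) a q := by
  refine ((hasSum_columnSum h1 (a + 1) (a + 1)).mul_left (q ^ (a + 2))).unique ?_
  refine ((hasSum_columnSum h1 a a).sub (hasSum_columnSum h1 (a + 1) a)).congr_fun fun j => ?_
  have hi := one_add_pow_ne_zero h1 (Nat.succ_ne_zero (j + (a + 1)))
  have hW := windowProd_ne_zero h1 j (a + 1)
  rw [windowProd_succ q j (a + 1)]
  field_simp
  ring

lemma exists_columnSum_self (a : ℕ) : ∃ f, IsRationalOnDisc f ∧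
    ∀ q : ℂ, 0 < ‖q‖ → ‖q‖ < 1 →
      Polynomial.aeval q (distinctPoly a a) * q ^ (a + 1) * columnSum a a q =
        f q + ∑' k : ℕ, q ^ (k + 1) / (1 + q ^ (k + 1)) := by
  induction a with
  | zero =>
    refine ⟨_, .aeval 0, fun q _ _ => ?_⟩
    simp only [distinctPoly, map_one, map_zero, columnSum, zero_add, one_mul]
    rw [← tsum_mul_left]
    refine tsum_congr fun j => ?_
    simp only [windowProd, range_one, prod_singleton]
    ring
  | succ a ih =>
    obtain ⟨f, hf, hfq⟩ := ih
    refine ⟨_, hf.sub (((IsRationalOnDisc.aeval (distinctPoly a a)).mul (.pow (a + 1))).mul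
      (isRationalOnDisc_columnSum 0 a)), fun q h0 h1 => ?_⟩
    rw [distinctPoly_succ_self, map_mul, map_pow, Polynomial.aeval_X, mul_assoc,
      columnSum_succ_succ h1]
    have := hfq q h0 h1
    simp only [add_zero]
    linear_combination this

lemma exists_hasSum_cellCount_distinct (a l : ℕ) :
    ∃ f, IsRationalOnDisc f ∧ ∀ q : ℂ, 0 < ‖q‖ → ‖q‖ < 1 →
      HasSum (fun s => (cellCount a l s : ℂ) * weight DistinctParts q s)
        (negqInf q * (f q + if a = l then ∑' k : ℕ, q ^ (k + 1) / (1 + q ^ (k + 1)) else 0)) := by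
  have hsum : ∀ q : ℂ, 0 < ‖q‖ → ‖q‖ < 1 →
      HasSum (fun s => (cellCount a l s : ℂ) * weight DistinctParts q s)
        (negqInf q * (Polynomial.aeval q (distinctPoly a l) * q ^ (a + 1) * columnSum a l q)) :=
    fun q h0 h1 => hasSum_cellCount_mul_weight
      (T := fun q => negqInf q *
        (Polynomial.aeval q (distinctPoly a l) * q ^ (a + 1) * columnSum a l q))
      (fun q _ h1 j => hasSum_hasCell_distinct h1 a l j)
      (fun q _ h1 => ((hasSum_columnSum h1 a l).mul_left _).mul_left _) h0 h1
  rcases lt_trichotomy a l with h | rfl | h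
  · refine ⟨_, .aeval 0, fun q h0 h1 => ?_⟩
    simpa [h.ne, distinctPoly_eq_zero h] using hsum q h0 h1
  · obtain ⟨f, hf, hfq⟩ := exists_columnSum_self a
    refine ⟨f, hf, fun q h0 h1 => ?_⟩
    rw [if_pos rfl, ← hfq q h0 h1]
    exact hsum q h0 h1
  · obtain ⟨d, rfl⟩ := Nat.exists_eq_add_of_le (Nat.succ_le_of_lt h)
    refine ⟨_, ((IsRationalOnDisc.aeval (distinctPoly (l + 1 + d) l)).mul
      (.pow (l + 1 + d + 1))).mul (isRationalOnDisc_columnSum d l), fun q h0 h1 => ?_⟩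
    rw [if_neg h.ne', add_zero]
    exact hsum q h0 h1

/-! ### The generating functions -/

lemma hasSum_sum_hookCount {C : Multiset ℕ → Prop} [DecidablePred C]
    (hC : ∀ s, C s → 0 ∉ s) {F : ∀ n, Finset (Nat.Partition n)}
    (hF : ∀ n (P : Nat.Partition n), P ∈ F n ↔ C P.parts) {q : ℂ} {m : ℕ} {A : ℕ × ℕ → ℂ}
    (hA : ∀ x, HasSum (fun s => (cellCount x.1 x.2 s : ℂ) * weight C q s) (A x)) :
    HasSum (fun n => ((∑ P ∈ F n, hookCount P (m + 1) : ℕ) : ℂ) * q ^ n)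
      (∑ x ∈ antidiagonal m, A x) := by
  have h := (hasSum_sum fun x (_ : x ∈ antidiagonal m) => hA x).sum_partition fun s h0 => by
    have hs : ¬ C s := fun h => hC s h h0
    simp [weight, hs]
  refine h.congr_fun fun n => ?_
  simp only [← sum_mul, hookCount_eq_sum_cellCount, Nat.cast_sum]
  exact (sum_partition_mul_weight (hF n)
    (fun s => ∑ x ∈ antidiagonal m, (cellCount x.1 x.2 s : ℂ)) q).symm

lemma sum_antidiagonal_diagonal (m : ℕ) (T : ℂ) :
    (∑ x ∈ antidiagonal m, if x.1 = x.2 then T else 0) = if Even m then T else 0 := by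
  split_ifs with hm
  · obtain ⟨r, rfl⟩ := hm
    rw [sum_eq_single (r, r)]
    · simp
    · rintro ⟨a, b⟩ hab hne
      rw [HasAntidiagonal.mem_antidiagonal] at hab
      refine if_neg fun h => hne ?_
      simp only at h hab
      ext <;> simp only <;> omega
    · simp
  · refine sum_eq_zero fun x hx => if_neg fun h => hm ⟨x.1, ?_⟩
    rw [HasAntidiagonal.mem_antidiagonal] at hx
    omega

/-- There are rational functions `Ã_h = PA/QA` and `B̃_h = PB/QB` with rational coefficients
such that for all `q` with `0 < |q| < 1`: `ã_h(q) = (−q;q)_∞ Ã_h(q)`;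
if `h` is even then `b̃_h(q) = (−q;q)_∞ B̃_h(q)`; and if `h` is odd then
`b̃_h(q) = (−q;q)_∞ (B̃_h(q) + Σ_{k=1}^∞ q^k/(1+q^k))`. -/
theorem atilde_btilde_rational (h : ℕ) (hh : 1 ≤ h) :
    ∃ PA QA PB QB : Polynomial ℚ, QA ≠ 0 ∧ QB ≠ 0 ∧
      ∀ q : ℂ, 0 < ‖q‖ → ‖q‖ < 1 →
        (atilde h q = negqInf q * (Polynomial.aeval q PA / Polynomial.aeval q QA)) ∧
        (Even h → btilde h q = negqInf q * (Polynomial.aeval q PB / Polynomial.aeval q QB)) ∧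
        (Odd h → btilde h q = negqInf q *
          (Polynomial.aeval q PB / Polynomial.aeval q QB +
            ∑' k : ℕ, q ^ (k + 1) / (1 + q ^ (k + 1)))) := by
  obtain ⟨m, rfl⟩ := Nat.exists_eq_add_of_le' hh
  choose f hf hfs using fun x : ℕ × ℕ => exists_hasSum_cellCount_odd x.1 x.2
  choose g hg hgs using fun x : ℕ × ℕ => exists_hasSum_cellCount_distinct x.1 x.2
  obtain ⟨PA, QA, hQA, hA⟩ := (IsRationalOnDisc.sum (antidiagonal m) hf).exists_ne_zero
  obtain ⟨PB, QB, hQB, hB⟩ := (IsRationalOnDisc.sum (antidiagonal m) hg).exists_ne_zero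
  refine ⟨PA, QA, PB, QB, hQA, hQB, fun q h0 h1 => ?_⟩
  have ha := (hasSum_sum_hookCount (fun _ hs => OddParts.zero_notMem hs)
    (fun n => mem_odds_iff (n := n)) (m := m) fun x => hfs x q h0 h1).tsum_eq
  have hb := (hasSum_sum_hookCount (fun _ hs => hs.2)
    (fun n => mem_distincts_iff (n := n)) (m := m) fun x => hgs x q h0 h1).tsum_eq
  rw [← mul_sum, hA q h0 h1] at ha
  rw [← mul_sum, sum_add_distrib, sum_antidiagonal_diagonal, hB q h0 h1] at hb
  refine ⟨ha, fun hm => ?_, fun hm => ?_⟩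
  · rw [if_neg (by simpa [Nat.even_add_one] using hm), add_zero] at hb
    exact hb
  · rw [if_pos (by simpa [Nat.odd_add_one] using hm)] at hb
    exact hb
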